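/- Suppose f : ℝ^d → ℝ is real-valued with f̂ ∈ L¹(ℝ^d), ‖f‖_{B^log} < ∞ and ‖f‖_{B⁰} > 0. For any m ∈ ℕ and any compact set Ω ⊂ [0,1]^d, there exist ReLU networks F₁,…,F_m : ℝ^d → ℝ, each of width 3, with depths L₁,…,L_m, such that ‖f − (1/m) ∑_{i=1}^m F_i‖²_{L²(Ω)} ≤ (3π⁴/m)·|Ω|·‖f‖²_{B⁰} and ∑_{i=1}^m L_i ≤ 5m·‖f‖_{B^log}/‖f‖_{B⁰}, where |Ω| is the Lebesgue measure of Ω. -/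

import Mathlib

open MeasureTheory Real Filter

noncomputable section

/-- The ℓ¹ norm on `ℝ^d`. -/
def l1 {d : ℕ} (ξ : Fin d → ℝ) : ℝ := ∑ i, |ξ i|

/-- The Fourier transform `f̂(ξ) = ∫ f(x) e^{-2πi ξ·x} dx`. -/
def fhat {d : ℕ} (f : (Fin d → ℝ) → ℂ) (ξ : Fin d → ℝ) : ℂ :=
  ∫ x : Fin d → ℝ,
    Complex.exp (-(2 * (Real.pi : ℂ) * Complex.I * ((∑ i, ξ i * x i : ℝ) : ℂ))) * f x

/-- Fourier transform of a real-valued function. -/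
def fhatR {d : ℕ} (f : (Fin d → ℝ) → ℝ) : (Fin d → ℝ) → ℂ :=
  fhat (fun x => (f x : ℂ))

/-- log-Barron norm `∫ log₂(2+‖ξ‖₁)|g(ξ)| dξ` of a frequency-side function `g`. -/
def logBarron {d : ℕ} (g : (Fin d → ℝ) → ℂ) : ℝ :=
  ∫ ξ : Fin d → ℝ, Real.logb 2 (2 + l1 ξ) * ‖g ξ‖

/-- Barron norm of order 0 : `∫ (1 + ‖ξ‖₁⁰)|g(ξ)| dξ = 2∫|g(ξ)|dξ`. -/
def B0 {d : ℕ} (g : (Fin d → ℝ) → ℂ) : ℝ := 2 * ∫ ξ : Fin d → ℝ, ‖g ξ‖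

/-- Barron norm of order 1 : `∫ (1 + ‖ξ‖₁)|g(ξ)| dξ`. -/
def B1 {d : ℕ} (g : (Fin d → ℝ) → ℂ) : ℝ := ∫ ξ : Fin d → ℝ, (1 + l1 ξ) * ‖g ξ‖

/-- first-order log-Barron norm `∫ (1+‖ξ‖₁) log₂(2+‖ξ‖₁)|g(ξ)| dξ`. -/
def B1log {d : ℕ} (g : (Fin d → ℝ) → ℂ) : ℝ :=
  ∫ ξ : Fin d → ℝ, (1 + l1 ξ) * Real.logb 2 (2 + l1 ξ) * ‖g ξ‖

/-- One hidden ReLU layer `z ↦ ReLU(Wz+b)`. -/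
def reluLayer {N : ℕ} (W : Matrix (Fin N) (Fin N) ℝ) (b : Fin N → ℝ) (z : Fin N → ℝ) :
    Fin N → ℝ :=
  fun i => max 0 (W.mulVec z i + b i)

/-- Iterate `k` hidden layers. -/
def hiddenIter {N : ℕ} (W : ℕ → Matrix (Fin N) (Fin N) ℝ) (b : ℕ → Fin N → ℝ) :
    ℕ → (Fin N → ℝ) → (Fin N → ℝ)
  | 0, z => z
  | k + 1, z => reluLayer (W k) (b k) (hiddenIter W b k z)

/-- `F : ℝ^d → ℝ` is a ReLU network of width `N` and depth `L`:
`F(x) = W_L z_{L-1}`, `z₀ = x`, `z_l = ReLU(W_l z_{l-1} + b_l)` for `1 ≤ l ≤ L-1`. -/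
def IsReLUNet (d N L : ℕ) (F : (Fin d → ℝ) → ℝ) : Prop :=
  ∃ (W₁ : Matrix (Fin N) (Fin d) ℝ) (b₁ : Fin N → ℝ)
    (W : ℕ → Matrix (Fin N) (Fin N) ℝ) (b : ℕ → Fin N → ℝ) (Wout : Fin N → ℝ),
    ∀ x, F x = ∑ i, Wout i *
      hiddenIter W b (L - 2) (fun j => max 0 (W₁.mulVec x j + b₁ j)) i

/-- `v` is the `j`-th weak partial derivative of `u` on `Ω`. -/
def HasWeakPartial {d : ℕ} (Ω : Set (Fin d → ℝ)) (u : (Fin d → ℝ) → ℝ) (j : Fin d)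
    (v : (Fin d → ℝ) → ℝ) : Prop :=
  ∀ φ : (Fin d → ℝ) → ℝ, ContDiff ℝ (⊤ : ℕ∞) φ → HasCompactSupport φ → tsupport φ ⊆ interior Ω →
    ∫ x in Ω, u x * fderiv ℝ φ x (Pi.single j 1) = - ∫ x in Ω, v x * φ x

/-- Euclidean diameter of a set in `ℝ^d`. -/
def eucDiam {d : ℕ} (Ω : Set (Fin d → ℝ)) : ℝ :=
  sSup {r : ℝ | ∃ x ∈ Ω, ∃ y ∈ Ω, r = Real.sqrt (∑ i, (x i - y i) ^ 2)}


open scoped FourierTransform RealInnerProductSpace in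
lemma ae_inversion {V : Type*} [NormedAddCommGroup V] [InnerProductSpace ℝ V]
    [FiniteDimensional ℝ V] [MeasurableSpace V] [BorelSpace V] (f : V → ℂ)
    (hf : Integrable f) (hf' : Integrable (𝓕 f)) : ∀ᵐ x, f x = 𝓕⁻ (𝓕 f) x := by
  have hsa : ∀ (u v : V → ℂ), Integrable u → Integrable v →
      ∫ x, 𝓕 u x * v x = ∫ x, u x * 𝓕 v x := by
    intro u v hu hv
    have := VectorFourier.integral_fourierIntegral_smul_eq_flip (L := innerₗ V)
      continuous_fourierChar continuous_inner hu hv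
    simpa using! this
  have hneg : Integrable (fun x => 𝓕 f (-x)) := hf'.comp_neg
  have hcont : Continuous (𝓕⁻ (𝓕 f)) := by
    rw [fourierInv_eq_fourier_comp_neg]
    exact VectorFourier.fourierIntegral_continuous Real.continuous_fourierChar
      (innerSL ℝ).continuous₂ hneg
  refine ae_eq_of_integral_contDiff_smul_eq hf.locallyIntegrable hcont.locallyIntegrable ?_
  intro g hg hgc
  have hc2 : HasCompactSupport (fun x => (g x : ℂ)) := hgc.comp_left (g := fun r : ℝ => (r : ℂ)) rfl
  let ψ : SchwartzMap V ℂ := hc2.toSchwartzMap (Complex.ofRealCLM.contDiff.comp hg)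
  have hψ : ∀ x, ψ x = (g x : ℂ) := fun x => rfl
  have h1 : ∀ x, 𝓕 (𝓕⁻ ψ : SchwartzMap V ℂ) x = ψ x := by
    intro x; rw [FourierTransform.fourier_fourierInv_eq]
  have e1 : ∫ x, g x • f x = ∫ x, 𝓕 f x * (𝓕⁻ ψ : SchwartzMap V ℂ) x := by
    rw [hsa f _ hf (SchwartzMap.integrable _)]
    congr 1; ext x
    rw [← SchwartzMap.fourier_coe, h1, hψ, Complex.real_smul, mul_comm]
  have e2 : ∫ x, g x • 𝓕⁻ (𝓕 f) x = ∫ x, 𝓕 f x * (𝓕⁻ ψ : SchwartzMap V ℂ) x := by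
    calc ∫ x, g x • 𝓕⁻ (𝓕 f) x = ∫ x, 𝓕 (fun x => 𝓕 f (-x)) x * ψ x := by
          congr 1; ext x
          rw [fourierInv_eq_fourier_comp_neg, hψ, Complex.real_smul, mul_comm]
      _ = ∫ x, 𝓕 f (-x) * 𝓕 (ψ : V → ℂ) x := hsa _ _ hneg ψ.integrable
      _ = ∫ x, 𝓕 f x * 𝓕 (ψ : V → ℂ) (-x) := by
          rw [← integral_neg_eq_self]; simp only [neg_neg]
      _ = _ := by
          rw [SchwartzMap.fourierInv_coe]
          simp only [fourierInv_eq_fourier_neg]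
  rw [e1, e2]

lemma f_integrable {d : ℕ} (f : (Fin d → ℝ) → ℝ) (hB0 : 0 < B0 (fhatR f)) :
    Integrable f := by
  by_contra h
  have : fhatR f = 0 := by
    ext ξ
    simp only [fhatR, fhat, Pi.zero_apply]
    apply integral_undef
    intro h2
    apply h
    have h3 := h2.bdd_mul (c := 1) (f := fun x : Fin d → ℝ =>
      Complex.exp ((2 * (Real.pi : ℂ) * Complex.I * ((∑ i, ξ i * x i : ℝ) : ℂ))))
      (by apply Continuous.aestronglyMeasurable; fun_prop)
      (by
        refine Filter.Eventually.of_forall fun x => ?_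
        rw [show (2 * (Real.pi : ℂ) * Complex.I * ((∑ i, ξ i * x i : ℝ) : ℂ)) =
          ((2 * Real.pi * (∑ i, ξ i * x i) : ℝ) : ℂ) * Complex.I by push_cast; ring,
          Complex.norm_exp_ofReal_mul_I])
    have h4 : Integrable (fun x => (f x : ℂ)) := by
      convert h3 using 2 with x
      rw [← mul_assoc, ← Complex.exp_add]
      simp
    simpa using h4.re
  rw [this] at hB0
  simp [B0] at hB0

open scoped FourierTransform RealInnerProductSpace in
lemma f_inversion {d : ℕ} (f : (Fin d → ℝ) → ℝ) (hf : Integrable f)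
    (hf1 : Integrable (fhatR f)) :
    ∀ᵐ x, f x = ∫ ξ : Fin d → ℝ, (fhatR f ξ * Complex.exp
      (((2 * Real.pi * (∑ i, ξ i * x i) : ℝ) : ℂ) * Complex.I)).re := by
  let f' : EuclideanSpace ℝ (Fin d) → ℂ := fun x => (f (WithLp.ofLp x) : ℂ)
  have mp := PiLp.volume_preserving_ofLp (Fin d)
  have mp' := PiLp.volume_preserving_toLp (Fin d)
  have me : MeasurableEmbedding (@WithLp.ofLp 2 (Fin d → ℝ)) :=
    (MeasurableEquiv.toLp 2 (Fin d → ℝ)).symm.measurableEmbedding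
  have hF : ∀ w : EuclideanSpace ℝ (Fin d), 𝓕 f' w = fhatR f (WithLp.ofLp w) := by
    intro w
    rw [fourier_eq']
    simp only [fhatR, fhat]
    rw [← mp.integral_comp me]
    congr 1; ext v
    simp only [f', smul_eq_mul, PiLp.inner_apply, RCLike.inner_apply, conj_trivial]
    congr 2
    push_cast
    rw [Finset.sum_congr rfl (fun i _ => mul_comm _ _)]
    ring
  have hF' : 𝓕 f' = fhatR f ∘ (@WithLp.ofLp 2 (Fin d → ℝ)) := funext hF
  have hi : Integrable f' := by
    have := (mp.integrable_comp_emb me (g := fun x => (f x : ℂ))).2 hf.ofReal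
    exact this
  have hi' : Integrable (𝓕 f') := by
    rw [hF']; exact (mp.integrable_comp_emb me).2 hf1
  have key := ae_inversion f' hi hi'
  have key2 := mp'.quasiMeasurePreserving.ae key
  filter_upwards [key2] with x hx
  rw [fourierInv_eq'] at hx
  have h3 : (f x : ℂ) = ∫ ξ : Fin d → ℝ, (fhatR f ξ * Complex.exp
      (((2 * Real.pi * (∑ i, ξ i * x i) : ℝ) : ℂ) * Complex.I)) := by
    change f' (WithLp.toLp 2 x) = _
    rw [hx, ← mp.integral_comp me]
    congr 1; ext v
    simp only [hF, smul_eq_mul, PiLp.inner_apply, RCLike.inner_apply, conj_trivial]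
    rw [mul_comm]
    rw [Finset.sum_congr rfl (fun i _ => mul_comm _ _)]
  have hI : Integrable (fun ξ : Fin d → ℝ => (fhatR f ξ * Complex.exp
      (((2 * Real.pi * (∑ i, ξ i * x i) : ℝ) : ℂ) * Complex.I))) := by
    refine hf1.mul_bdd (c := 1) (by apply Continuous.aestronglyMeasurable; fun_prop)
      (Filter.Eventually.of_forall fun ξ => ?_)
    rw [Complex.norm_exp_ofReal_mul_I]
  have := integral_re hI
  simp only [RCLike.re_to_complex] at this
  rw [this, ← h3, Complex.ofReal_re]

lemma greedy {A X : Type*} [MeasurableSpace A] [MeasurableSpace X] (P : Measure A)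
    [IsProbabilityMeasure P] (μ : Measure X) [IsFiniteMeasure μ] (G : A → X → ℝ)
    (hG : Measurable (Function.uncurry G)) (M : ℝ) (hM : ∀ a x, |G a x| ≤ M)
    (κ : A → ℝ) (hκ : Integrable κ P) (lam : ℝ) (h : X → ℝ)
    (hh : ∀ x, h x = ∫ a, G a x ∂P) (n : ℕ) :
    ∃ w : Fin n → A, Integrable (fun x => (∑ i, (h x - G (w i) x)) ^ 2) μ ∧
      ∫ x, (∑ i, (h x - G (w i) x)) ^ 2 ∂μ + lam * ∑ i, κ (w i) ≤
      n * (M ^ 2 * μ.real Set.univ + lam * ∫ a, κ a ∂P) := by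
  have hGa : ∀ a, Measurable (G a) := fun a => hG.comp measurable_prodMk_left
  have hGx : ∀ x, Measurable (fun a => G a x) := fun x => hG.comp measurable_prodMk_right
  have hhm : Measurable h := by
    have : h = fun x => ∫ a, G a x ∂P := funext hh
    rw [this]
    exact (StronglyMeasurable.integral_prod_left (f := G) hG.stronglyMeasurable).measurable
  have hGi : ∀ x, Integrable (fun a => G a x) P := fun x =>
    Integrable.of_bound (hGx x).aestronglyMeasurable M (Filter.Eventually.of_forall fun a => hM a x)
  have hG2i : ∀ x, Integrable (fun a => G a x ^ 2) P := fun x => by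
    refine Integrable.of_bound ((hGx x).pow_const 2).aestronglyMeasurable (M ^ 2)
      (Filter.Eventually.of_forall fun a => ?_)
    rw [Real.norm_eq_abs, abs_pow]
    exact pow_le_pow_left₀ (abs_nonneg _) (hM a x) 2
  have hhb : ∀ x, |h x| ≤ M := by
    intro x
    rw [hh]
    have := norm_integral_le_of_norm_le_const (μ := P) (f := fun a => G a x) (C := M)
      (Filter.Eventually.of_forall fun a => hM a x)
    simpa using this
  have hSm' : ∀ {n : ℕ} (w : Fin n → A), Measurable (fun x => ∑ i, (h x - G (w i) x)) :=
    fun w => Finset.measurable_sum _ fun i _ => hhm.sub (hGa _)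
  have hB' : ∀ {n : ℕ} (w : Fin n → A), ∃ B, ∀ x, |∑ i, (h x - G (w i) x)| ≤ B := by
    intro n w
    refine ⟨∑ i : Fin n, (M + M), fun x => ?_⟩
    refine (Finset.abs_sum_le_sum_abs _ _).trans (Finset.sum_le_sum fun i _ => ?_)
    exact (abs_sub _ _).trans (add_le_add (hhb x) (hM _ _))
  have hint : ∀ {n : ℕ} (w : Fin n → A), Integrable (fun x => (∑ i, (h x - G (w i) x)) ^ 2) μ := by
    intro n w
    obtain ⟨B, hB⟩ := hB' w
    refine Integrable.of_bound ((hSm' w).pow_const 2).aestronglyMeasurable (B ^ 2)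
        (Filter.Eventually.of_forall fun a => ?_)
    rw [Real.norm_eq_abs, abs_pow]
    exact pow_le_pow_left₀ (abs_nonneg _) (hB _) 2
  induction n with
  | zero => exact ⟨fun i => i.elim0, by simp, by simp⟩
  | succ n ih =>
    obtain ⟨w, -, hw⟩ := ih
    set S : X → ℝ := fun x => ∑ i, (h x - G (w i) x) with hS
    have hSm : Measurable S := hSm' w
    obtain ⟨B, hB⟩ := hB' w
    have hSi : Integrable (fun x => S x ^ 2) μ := hint w
    have hjoint : Integrable (Function.uncurry fun a x => (S x + (h x - G a x)) ^ 2) (P.prod μ) := by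
      refine Integrable.of_bound (C := (B + (M + M)) ^ 2) ?_ (Filter.Eventually.of_forall fun p => ?_)
      · apply Measurable.aestronglyMeasurable
        have : Measurable fun p : A × X => (S p.2 + (h p.2 - (Function.uncurry G) p)) ^ 2 := by
          fun_prop
        exact this
      · simp only [Function.uncurry, Real.norm_eq_abs]
        rw [abs_pow]
        refine pow_le_pow_left₀ (abs_nonneg _) ?_ 2
        refine (abs_add_le _ _).trans (add_le_add (hB _) ?_)
        exact (abs_sub _ _).trans (add_le_add (hhb _) (hM _ _))
    have hΦ1 : Integrable (fun a => ∫ x, (S x + (h x - G a x)) ^ 2 ∂μ) P := hjoint.integral_prod_left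
    have hΦ : Integrable (fun a => ∫ x, (S x + (h x - G a x)) ^ 2 ∂μ + lam * κ a) P :=
      hΦ1.add (hκ.const_mul lam)
    obtain ⟨a, ha⟩ := exists_le_integral hΦ
    rw [integral_add hΦ1 (hκ.const_mul lam), integral_const_mul, integral_integral_swap hjoint] at ha
    have hinner : ∀ x, ∫ a, (S x + (h x - G a x)) ^ 2 ∂P ≤ S x ^ 2 + M ^ 2 := by
      intro x
      have e : (fun a => (S x + (h x - G a x)) ^ 2) =
        fun a => ((S x + h x) ^ 2 - 2 * (S x + h x) * G a x) + G a x ^ 2 := by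
        ext a; ring
      have i1 : Integrable (fun a => (S x + h x) ^ 2 - 2 * (S x + h x) * G a x) P :=
        (integrable_const _).sub ((hGi x).const_mul _)
      rw [e, integral_add i1 (hG2i x),
        integral_sub (integrable_const _) ((hGi x).const_mul _), integral_const_mul, ← hh]
      have : ∫ a, G a x ^ 2 ∂P ≤ ∫ a, M ^ 2 ∂P := by
        refine integral_mono (hG2i x) (integrable_const _) fun a => ?_
        exact sq_le_sq' (by linarith [(abs_le.1 (hM a x)).1]) (abs_le.1 (hM a x)).2
      simp only [integral_const, probReal_univ, one_smul] at this ⊢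
      nlinarith [sq_nonneg (h x)]
    have hmono : ∫ x, ∫ a, (S x + (h x - G a x)) ^ 2 ∂P ∂μ ≤ ∫ x, (S x ^ 2 + M ^ 2) ∂μ :=
      integral_mono hjoint.integral_prod_right (hSi.add (integrable_const _)) hinner
    rw [integral_add hSi (integrable_const _)] at hmono
    simp only [integral_const, smul_eq_mul] at hmono
    refine ⟨Fin.snoc w a, hint _, ?_⟩
    simp only [Fin.sum_univ_castSucc, Fin.snoc_castSucc, Fin.snoc_last]
    push_cast
    have : ∀ x, ∑ i, (h x - G (w i) x) = S x := fun x => rfl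
    simp only [this] at hw ⊢
    nlinarith

def tent (u : ℝ) : ℝ := min (2 * u) (2 - 2 * u)

lemma tent_mem {u : ℝ} (h : u ∈ Set.Icc (0 : ℝ) 1) : tent u ∈ Set.Icc (0 : ℝ) 1 := by
  obtain ⟨h0, h1⟩ := h
  constructor
  · exact le_min (by linarith) (by linarith)
  · rcases le_total u (1/2) with h | h
    · exact (min_le_left _ _).trans (by linarith)
    · exact (min_le_right _ _).trans (by linarith)

lemma tent_iter_mem {u : ℝ} (h : u ∈ Set.Icc (0 : ℝ) 1) (k : ℕ) :
    tent^[k] u ∈ Set.Icc (0 : ℝ) 1 := by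
  induction k with
  | zero => exact h
  | succ k ih => rw [Function.iterate_succ_apply']; exact tent_mem ih

lemma tent_relu {u : ℝ} (h : u ∈ Set.Icc (0 : ℝ) 1) :
    max 0 (2 * u) - max 0 (4 * u - 2) = tent u := by
  obtain ⟨h0, h1⟩ := h
  rw [tent, max_eq_right (by linarith)]
  rcases le_total u (1/2) with h | h
  · rw [max_eq_left (by linarith), min_eq_left (by linarith)]; ring
  · rw [max_eq_right (by linarith), min_eq_right (by linarith)]; ring

lemma cos_tent (u : ℝ) : cos (2 * π * tent u) = cos (2 * π * (2 * u)) := by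
  rw [tent]
  rcases min_choice (2 * u) (2 - 2 * u) with h | h <;> rw [h]
  rw [show 2 * π * (2 - 2 * u) = ((2 : ℕ) : ℝ) * (2 * π) - 2 * π * (2 * u) by push_cast; ring,
    Real.cos_nat_mul_two_pi_sub]

lemma cos_tent_iter (k : ℕ) : ∀ u : ℝ, cos (2 * π * tent^[k] u) = cos (2 * π * (2 ^ k * u)) := by
  induction k with
  | zero => intro u; simp
  | succ k ih =>
    intro u
    rw [Function.iterate_succ_apply, ih]
    have h := congrArg (fun c => (Polynomial.Chebyshev.T ℝ ((2:ℤ) ^ k)).eval c) (cos_tent u)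
    simp only [Polynomial.Chebyshev.T_real_cos] at h
    push_cast at h
    rw [show 2 * π * (2 ^ k * tent u) = 2 ^ k * (2 * π * tent u) by ring, h]
    congr 1; ring

/-- the fold-free final readout -/
def cap (s c t y : ℝ) : ℝ :=
  s * (-1 + c * (max 0 (y - 1/2 - t) + max 0 (1/2 - t - y)))

lemma net_exists {d : ℕ} (k : ℕ) (w : Fin d → ℝ) (β s c t : ℝ) :
    ∃ F : (Fin d → ℝ) → ℝ, IsReLUNet d 3 (k + 2) F ∧
      ∀ x, (∑ i, w i * x i) + β ∈ Set.Icc (0 : ℝ) 1 →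
        F x = cap s c t (tent^[k] ((∑ i, w i * x i) + β)) := by
  have hmv : ∀ (a : ℝ) (x : Fin d → ℝ), ∑ i, a * w i * x i = a * ∑ i, w i * x i := by
    intro a x; rw [Finset.mul_sum]; exact Finset.sum_congr rfl fun i _ => by ring
  rcases k with _ | k
  · let W₁ : Matrix (Fin 3) (Fin d) ℝ := ![fun i => 1 * w i, fun i => (-1) * w i, fun i => 0 * w i]
    let b₁ : Fin 3 → ℝ := ![β - 1/2 - t, 1/2 - t - β, 1]
    let Wout : Fin 3 → ℝ := ![s * c, s * c, -s]
    refine ⟨_, ⟨W₁, b₁, 0, 0, Wout, fun x => rfl⟩, ?_⟩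
    intro x hx
    simp only [Nat.zero_add, Nat.sub_self, hiddenIter, Fin.sum_univ_three, Matrix.mulVec,
      dotProduct, W₁, b₁, Wout, cap, Function.iterate_zero, id]
    simp only [Matrix.cons_val_zero, Matrix.cons_val_one, Matrix.cons_val, hmv]
    rw [show 1 * ∑ i, w i * x i + (β - 1/2 - t) = ∑ i, w i * x i + β - 1/2 - t by ring,
      show -1 * ∑ i, w i * x i + (1/2 - t - β) = 1/2 - t - (∑ i, w i * x i + β) by ring,
      show 0 * ∑ i, w i * x i + 1 = (1:ℝ) by ring, max_eq_right (zero_le_one)]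
    ring
  · let W₁ : Matrix (Fin 3) (Fin d) ℝ := ![fun i => 2 * w i, fun i => 4 * w i, fun i => 0 * w i]
    let b₁ : Fin 3 → ℝ := ![2 * β, 4 * β - 2, 0]
    let T : Matrix (Fin 3) (Fin 3) ℝ := Matrix.of ![![2, -2, 0], ![4, -4, 0], ![0, 0, 0]]
    let R : Matrix (Fin 3) (Fin 3) ℝ := Matrix.of ![![1, -1, 0], ![-1, 1, 0], ![0, 0, 0]]
    let W : ℕ → Matrix (Fin 3) (Fin 3) ℝ := fun j => if j = k then R else T
    let b : ℕ → Fin 3 → ℝ := fun j => if j = k then ![- 1/2 - t, 1/2 - t, 1] else ![0, -2, 0]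
    let Wout : Fin 3 → ℝ := ![s * c, s * c, -s]
    refine ⟨_, ⟨W₁, b₁, W, b, Wout, fun x => rfl⟩, ?_⟩
    intro x hx
    set u := (∑ i, w i * x i) + β with hu
    set z : Fin 3 → ℝ := fun j => max 0 (W₁.mulVec x j + b₁ j) with hz
    have key : ∀ j ≤ k, hiddenIter W b j z 0 - hiddenIter W b j z 1 = tent^[j + 1] u := by
      intro j
      induction j with
      | zero =>
        intro _
        simp only [hiddenIter, hz, Matrix.mulVec, dotProduct, W₁, b₁, Matrix.cons_val_zero,
          Matrix.cons_val_one, hmv, zero_add, Function.iterate_one]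
        rw [← tent_relu hx]
        congr 2 <;> rw [hu] <;> ring
      | succ j ih =>
        intro hj
        have h1 := ih (by omega)
        rw [Function.iterate_succ_apply', ← h1]
        have hm : hiddenIter W b j z 0 - hiddenIter W b j z 1 ∈ Set.Icc (0:ℝ) 1 := by
          rw [h1]; exact tent_iter_mem hx _
        rw [← tent_relu hm]
        have hne : j ≠ k := by omega
        have hW : W j = T := if_neg hne
        have hb : b j = ![0, -2, 0] := if_neg hne
        simp only [hiddenIter, reluLayer]
        rw [hW, hb]
        simp only [T, Matrix.mulVec, dotProduct, Matrix.of_apply,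
          Fin.sum_univ_three, Matrix.cons_val_zero, Matrix.cons_val_one, Matrix.cons_val]
        congr 2 <;> ring
    have hk := key k le_rfl
    rw [show k + 1 + 2 - 2 = k + 1 by omega, ← hk]
    have hW : W k = R := if_pos rfl
    have hb : b k = ![- 1/2 - t, 1/2 - t, 1] := if_pos rfl
    simp only [hiddenIter, reluLayer]
    rw [hW, hb]
    simp only [R, Matrix.mulVec, dotProduct, Matrix.of_apply,
          Fin.sum_univ_three, Matrix.cons_val_zero, Matrix.cons_val_one, Matrix.cons_val, Wout, cap]
    generalize hiddenIter _ _ k z 0 = p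
    generalize hiddenIter _ _ k z 1 = q
    generalize hiddenIter _ _ k z 2 = r
    rw [show 1 * p + -1 * q + 0 * r + (-1/2 - t) = p - q - 1/2 - t by ring,
      show -1 * p + 1 * q + 0 * r + (1/2 - t) = 1/2 - t - (p - q) by ring,
      show 0 * p + 0 * q + 0 * r + 1 = (1:ℝ) by ring, max_eq_right (zero_le_one)]
    ring

lemma cap_bound {y t : ℝ} (hy : y ∈ Set.Icc (0 : ℝ) 1) (ht : 0 ≤ t) {s c C : ℝ}
    (hs : |s| ≤ C) (hc : |c| ≤ 2 * π ^ 2) : |cap s c t y| ≤ (1 + π ^ 2) * C := by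
  obtain ⟨h0, h1⟩ := hy
  have hr : max 0 (y - 1/2 - t) + max 0 (1/2 - t - y) ≤ 1/2 := by
    rcases max_cases 0 (y - 1/2 - t) with h | h <;>
    rcases max_cases 0 (1/2 - t - y) with h' | h' <;> linarith
  have hr0 : 0 ≤ max 0 (y - 1/2 - t) + max 0 (1/2 - t - y) := by positivity
  rw [cap, abs_mul, mul_comm]
  refine mul_le_mul ?_ hs (abs_nonneg _) (by positivity)
  refine (abs_add_le _ _).trans ?_
  rw [abs_neg, abs_one, abs_mul, abs_of_nonneg hr0]
  nlinarith [abs_nonneg c, sq_nonneg π]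

lemma relu_integral (z : ℝ) (hz0 : 0 ≤ z) (hz : z ≤ 1/2) :
    ∫ t in (0:ℝ)..1, 2 * π ^ 2 * cos (π * t) * max 0 (z - t / 2) = 1 - cos (2 * π * z) := by
  have hc : ∀ a b : ℝ, IntervalIntegrable
      (fun t : ℝ => 2 * π ^ 2 * cos (π * t) * max 0 (z - t / 2)) volume a b := by
    intro a b; apply Continuous.intervalIntegrable; fun_prop
  rw [← intervalIntegral.integral_add_adjacent_intervals (hc 0 (2 * z)) (hc (2 * z) 1)]
  have e2 : ∫ t in (2 * z)..1, 2 * π ^ 2 * cos (π * t) * max 0 (z - t / 2) = ∫ t in (2*z)..1, (0:ℝ) := by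
    apply intervalIntegral.integral_congr
    intro t ht
    rw [Set.uIcc_of_le (by linarith)] at ht
    simp only
    rw [max_eq_left (by linarith [ht.1]), mul_zero]
  have e1 : ∫ t in (0:ℝ)..(2 * z), 2 * π ^ 2 * cos (π * t) * max 0 (z - t / 2) =
      ∫ t in (0:ℝ)..(2*z), 2 * π ^ 2 * cos (π * t) * (z - t / 2) := by
    apply intervalIntegral.integral_congr
    intro t ht
    rw [Set.uIcc_of_le (by linarith)] at ht
    simp only
    rw [max_eq_right (by linarith [ht.2])]
  have e3 : ∫ t in (0:ℝ)..(2*z), 2 * π ^ 2 * cos (π * t) * (z - t / 2) =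
      (2 * π * sin (π * (2*z)) * (z - (2*z) / 2) - cos (π * (2*z))) -
      (2 * π * sin (π * 0) * (z - 0 / 2) - cos (π * 0)) := by
    apply intervalIntegral.integral_eq_sub_of_hasDerivAt
      (f := fun t => 2 * π * sin (π * t) * (z - t / 2) - cos (π * t))
    · intro t _
      have h1 : HasDerivAt (fun t : ℝ => π * t) π t := by
        simpa using (hasDerivAt_id t).const_mul π
      have h2 : HasDerivAt (fun t : ℝ => z - t / 2) (-(1/2)) t := by
        simpa using ((hasDerivAt_id t).div_const 2).const_sub z
      exact (((h1.sin.const_mul (2 * π)).mul h2).sub h1.cos).congr_deriv (by ring)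
    · apply Continuous.intervalIntegrable; fun_prop
  rw [e1, e2, e3]
  simp
  ring_nf

lemma cap_integral {y : ℝ} (hy : y ∈ Set.Icc (0 : ℝ) 1) (s : ℝ) :
    ∫ t in (0:ℝ)..1, cap s (2 * π ^ 2 * cos (π * t)) (t / 2) y = s * cos (2 * π * y) := by
  obtain ⟨h0, h1⟩ := hy
  have hz := relu_integral |y - 1/2| (abs_nonneg _) (abs_le.2 ⟨by linarith, by linarith⟩)
  have hcos : cos (2 * π * |y - 1/2|) = - cos (2 * π * y) := by
    rw [← abs_of_pos Real.two_pi_pos, ← abs_mul, Real.cos_abs, abs_of_pos Real.two_pi_pos,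
      show 2 * π * (y - 1/2) = 2 * π * y - π by ring, Real.cos_sub_pi]
  have : ∫ t in (0:ℝ)..1, cap s (2 * π ^ 2 * cos (π * t)) (t / 2) y =
      ∫ t in (0:ℝ)..1, s * (-1 + 2 * π ^ 2 * cos (π * t) * max 0 (|y - 1/2| - t / 2)) := by
    apply intervalIntegral.integral_congr
    intro t ht
    rw [Set.uIcc_of_le zero_le_one] at ht
    simp only [cap]
    congr 3
    rcases le_total 0 (y - 1/2) with h | h
    · rw [abs_of_nonneg h, max_eq_left (a := 0) (b := 1/2 - t/2 - y) (by linarith [ht.1]), add_zero]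
    · rw [abs_of_nonpos h, max_eq_left (a := 0) (b := y - 1/2 - t/2) (by linarith [ht.1]), zero_add]
      congr 1; ring
  rw [this, intervalIntegral.integral_const_mul, intervalIntegral.integral_add, hz, hcos]
  · simp
  · simp
  · apply Continuous.intervalIntegrable; fun_prop

lemma depth_bound {r : ℝ} (hr : 0 ≤ r) :
    (⌈logb 2 (1/2 + r)⌉₊ : ℝ) ≤ 8 / 9 * (5 / 2 * logb 2 (2 + r) - 2) := by
  have h1 : 1 ≤ logb 2 (2 + r) := by
    rw [Real.le_logb_iff_rpow_le (by norm_num) (by linarith)]; simpa using hr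
  rcases Nat.eq_zero_or_pos ⌈logb 2 (1/2 + r)⌉₊ with h | h
  · rw [h]; push_cast; linarith
  have hpos : 0 < logb 2 (1/2 + r) := Nat.ceil_pos.1 h
  have hr2 : 1 / 2 < r := by
    have := (Real.logb_pos_iff (by norm_num : (1:ℝ) < 2) (by linarith)).1 hpos
    linarith
  have hlt := Nat.ceil_lt_add_one hpos.le
  have e1 : logb 2 (1/2 + r) + 1 + logb 2 3 ≤ 2 * logb 2 (2 + r) := by
    have a1 : logb 2 (1/2 + r) + 1 + logb 2 3 = logb 2 ((1/2 + r) * 2 * 3) := by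
      rw [Real.logb_mul (by positivity) (by norm_num), Real.logb_mul (by positivity) (by norm_num),
        Real.logb_self_eq_one (by norm_num)]
    have a2 : 2 * logb 2 (2 + r) = logb 2 ((2 + r) ^ 2) := by
      rw [Real.logb_pow]; norm_num
    rw [a1, a2]
    apply Real.logb_le_logb_of_le (by norm_num) (by positivity)
    nlinarith [sq_nonneg (r - 1)]
  have e2 : 3 ≤ 2 * logb 2 3 := by
    have : 2 * logb 2 3 = logb 2 (3 ^ 2) := by rw [Real.logb_pow]; norm_num
    rw [this, Real.le_logb_iff_rpow_le (by norm_num) (by norm_num)]; norm_num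
  have e3 : 5 ≤ 4 * logb 2 (2 + r) := by
    have : 4 * logb 2 (2 + r) = logb 2 ((2 + r) ^ 4) := by rw [Real.logb_pow]; norm_num
    rw [this, Real.le_logb_iff_rpow_le (by norm_num) (by positivity)]
    have : (5/2:ℝ) ^ 4 ≤ (2 + r) ^ 4 := pow_le_pow_left₀ (by norm_num) (by linarith) 4
    norm_num at this ⊢
    linarith
  linarith

section construction
variable {d : ℕ} (g : (Fin d → ℝ) → ℂ)

def kk (ξ : Fin d → ℝ) : ℕ := ⌈logb 2 (1/2 + l1 ξ)⌉₊
def ph (ξ : Fin d → ℝ) : ℝ := (g ξ).arg / (2 * π)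
def jj (ξ : Fin d → ℝ) : ℤ := ⌊2 * (∑ i, min 0 (ξ i) + ph g ξ)⌋
def wt (ξ : Fin d → ℝ) (i : Fin d) : ℝ := ξ i / 2 ^ kk ξ
def bt (ξ : Fin d → ℝ) : ℝ := (ph g ξ - jj g ξ / 2) / 2 ^ kk ξ
def GG (C : ℝ) (a : (Fin d → ℝ) × ℝ) (x : Fin d → ℝ) : ℝ :=
  cap (C * cos (π * jj g a.1)) (2 * π ^ 2 * cos (π * a.2)) (|a.2| / 2)
    (tent^[kk a.1] ((∑ i, wt a.1 i * x i) + bt g a.1))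

lemma l1_nonneg (ξ : Fin d → ℝ) : 0 ≤ l1 ξ := Finset.sum_nonneg fun i _ => abs_nonneg _

lemma u_eq (ξ x : Fin d → ℝ) : (∑ i, wt ξ i * x i) + bt g ξ =
    (∑ i, ξ i * x i + (ph g ξ - jj g ξ / 2)) / 2 ^ kk ξ := by
  simp only [wt, bt]
  rw [add_div, Finset.sum_div]
  congr 1
  exact Finset.sum_congr rfl fun i _ => by ring

lemma u_mem (ξ x : Fin d → ℝ) (hx : x ∈ Set.Icc (0 : Fin d → ℝ) 1) :
    (∑ i, wt ξ i * x i) + bt g ξ ∈ Set.Icc (0 : ℝ) 1 := by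
  rw [u_eq]
  have h0 : ∀ i, 0 ≤ x i := fun i => hx.1 i
  have h1 : ∀ i, x i ≤ 1 := fun i => hx.2 i
  have hlo : ∑ i, min 0 (ξ i) ≤ ∑ i, ξ i * x i := by
    refine Finset.sum_le_sum fun i _ => ?_
    rcases min_cases 0 (ξ i) with h | h <;> nlinarith [h0 i, h1 i]
  have hhi : ∑ i, ξ i * x i ≤ ∑ i, min 0 (ξ i) + l1 ξ := by
    rw [l1, ← Finset.sum_add_distrib]
    refine Finset.sum_le_sum fun i _ => ?_
    rcases min_cases 0 (ξ i) with h | h <;> rcases abs_cases (ξ i) with h' | h' <;>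
      nlinarith [h0 i, h1 i]
  have f1 := Int.floor_le (2 * (∑ i, min 0 (ξ i) + ph g ξ))
  have f2 := Int.lt_floor_add_one (2 * (∑ i, min 0 (ξ i) + ph g ξ))
  have hk : 1/2 + l1 ξ ≤ 2 ^ kk ξ := by
    have hp : 0 < 1/2 + l1 ξ := by linarith [l1_nonneg ξ]
    have := (Real.logb_le_iff_le_rpow (b := 2) (by norm_num) hp).1 (Nat.le_ceil (logb 2 (1/2 + l1 ξ)))
    rw [Real.rpow_natCast] at this
    exact this
  change ((jj g ξ : ℤ) : ℝ) ≤ _ at f1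
  change _ < ((jj g ξ : ℤ) : ℝ) + 1 at f2
  constructor
  · apply div_nonneg _ (by positivity)
    linarith
  · rw [div_le_one (by positivity)]
    linarith

lemma cos_id (ξ x : Fin d → ℝ) :
    cos (π * jj g ξ) * cos (2 * π * tent^[kk ξ] ((∑ i, wt ξ i * x i) + bt g ξ)) =
      cos (2 * π * (∑ i, ξ i * x i) + (g ξ).arg) := by
  rw [cos_tent_iter, u_eq, mul_div_cancel₀ _ (by positivity)]
  have e : 2 * π * (∑ i, ξ i * x i) + (g ξ).arg =
      2 * π * (∑ i, ξ i * x i + (ph g ξ - jj g ξ / 2)) + π * jj g ξ := by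
    simp only [ph]; field_simp; ring
  rw [e, Real.cos_add, mul_comm π (jj g ξ : ℝ), Real.sin_int_mul_pi]
  ring

lemma GG_bound {C : ℝ} (hC : 0 ≤ C) (a : (Fin d → ℝ) × ℝ) (x : Fin d → ℝ)
    (hx : x ∈ Set.Icc (0 : Fin d → ℝ) 1) : |GG g C a x| ≤ (1 + π ^ 2) * C := by
  apply cap_bound (tent_iter_mem (u_mem g _ _ hx) _) (by positivity)
  · rw [abs_mul, abs_of_nonneg hC]
    exact mul_le_of_le_one_right hC (Real.abs_cos_le_one _)
  · rw [abs_mul, abs_of_nonneg (by positivity)]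
    exact mul_le_of_le_one_right (by positivity) (Real.abs_cos_le_one _)

lemma GG_int (C : ℝ) (ξ x : Fin d → ℝ) (hx : x ∈ Set.Icc (0 : Fin d → ℝ) 1) :
    ∫ t in Set.Ioc (0:ℝ) 1, GG g C (ξ, t) x = C * cos (2 * π * (∑ i, ξ i * x i) + (g ξ).arg) := by
  rw [← intervalIntegral.integral_of_le zero_le_one, ← cos_id, ← mul_assoc,
    ← cap_integral (tent_iter_mem (u_mem g _ _ hx) _)]
  apply intervalIntegral.integral_congr
  intro t ht
  rw [Set.uIcc_of_le zero_le_one] at ht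
  simp only [GG]
  rw [abs_of_nonneg ht.1]

lemma kk_meas : Measurable (kk : (Fin d → ℝ) → ℕ) := by
  unfold kk l1
  apply Nat.measurable_ceil.comp
  unfold logb
  fun_prop

lemma GG_meas (hg : Measurable g) (C : ℝ) : Measurable (Function.uncurry (GG g C)) := by
  have hk := kk_meas (d := d)
  have hph : Measurable (ph g) := by
    unfold ph; exact (Complex.measurable_arg.comp hg).div_const _
  have hj : Measurable (jj g) := by
    unfold jj
    apply Int.measurable_floor.comp
    fun_prop
  have hj' : Measurable (fun ξ => ((jj g ξ : ℤ) : ℝ)) := (measurable_from_top).comp hj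
  have hp : Measurable (fun ξ : Fin d → ℝ => (2:ℝ) ^ kk ξ) := (measurable_from_top (f := fun n : ℕ => (2:ℝ)^n)).comp hk
  have hu : Measurable (fun p : ((Fin d → ℝ) × ℝ) × (Fin d → ℝ) =>
      (∑ i, wt p.1.1 i * p.2 i) + bt g p.1.1) := by
    simp only [u_eq]
    fun_prop
  have htent : Measurable tent := by unfold tent; fun_prop
  have hit : Measurable (fun q : ℕ × ℝ => tent^[q.1] q.2) :=
    measurable_from_prod_countable_right fun n => htent.iterate n
  have hy := hit.comp ((hk.comp (measurable_fst.comp measurable_fst)).prodMk hu)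
  simp only [Function.comp_def] at hy
  unfold GG cap Function.uncurry
  fun_prop

end construction

lemma core {d : ℕ} (g : (Fin d → ℝ) → ℂ) (hg : Measurable g) (hgi : Integrable g)
    (hlog : Integrable (fun ξ => Real.logb 2 (2 + l1 ξ) * ‖g ξ‖)) (C : ℝ)
    (hC : C = ∫ ξ, ‖g ξ‖) (hC0 : 0 < C) (Ω : Set (Fin d → ℝ)) (hΩc : IsCompact Ω)
    (hΩ : Ω ⊆ Set.Icc 0 1) (hvol : 0 < volume.real Ω) (m : ℕ) (hm : 0 < m)
    (h : (Fin d → ℝ) → ℝ)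
    (hh : ∀ x, h x = ∫ ξ : Fin d → ℝ, (g ξ * Complex.exp
      (((2 * Real.pi * (∑ i, ξ i * x i) : ℝ) : ℂ) * Complex.I)).re) :
    ∃ (L : Fin m → ℕ) (F : Fin m → (Fin d → ℝ) → ℝ),
      (∀ i, IsReLUNet d 3 (L i) (F i)) ∧
      (∫⁻ x in Ω, ENNReal.ofReal ((h x - (1 / m) * ∑ i, F i x) ^ 2)) ≤
        ENNReal.ofReal (12 * Real.pi ^ 4 / m * volume.real Ω * C ^ 2) ∧
      (∑ i, (L i : ℝ)) ≤ m * (5 / 2 * logBarron g / C) := by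
  have hΩm : MeasurableSet Ω := hΩc.measurableSet
  have hΩtop : volume Ω ≠ ⊤ := hΩc.measure_lt_top.ne
  have hgn : Measurable (fun ξ => ENNReal.ofReal (‖g ξ‖ / C)) := by fun_prop
  let P1 : Measure (Fin d → ℝ) := volume.withDensity (fun ξ => ENNReal.ofReal (‖g ξ‖ / C))
  have hP1int : ∀ φ : (Fin d → ℝ) → ℝ, ∫ ξ, φ ξ ∂P1 = ∫ ξ, ‖g ξ‖ / C * φ ξ := by
    intro φ
    rw [integral_withDensity_eq_integral_toReal_smul hgn
      (Filter.Eventually.of_forall fun _ => ENNReal.ofReal_lt_top)]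
    congr 1; ext ξ
    rw [ENNReal.toReal_ofReal (by positivity), smul_eq_mul]
  have hP1i : ∀ φ : (Fin d → ℝ) → ℝ, Integrable (fun ξ => ‖g ξ‖ / C * φ ξ) → Integrable φ P1 := by
    intro φ hφ
    rw [integrable_withDensity_iff_integrable_smul' hgn
      (Filter.Eventually.of_forall fun _ => ENNReal.ofReal_lt_top)]
    refine hφ.congr (Filter.Eventually.of_forall fun ξ => ?_)
    simp only [smul_eq_mul]
    rw [ENNReal.toReal_ofReal (by positivity)]
  haveI : IsProbabilityMeasure P1 := by
    constructor
    rw [withDensity_apply _ MeasurableSet.univ, Measure.restrict_univ,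
      ← ofReal_integral_eq_lintegral_ofReal (hgi.norm.div_const C)
        (Filter.Eventually.of_forall fun ξ => by positivity), integral_div, ← hC,
      div_self hC0.ne', ENNReal.ofReal_one]
  let U : Measure ℝ := volume.restrict (Set.Ioc 0 1)
  haveI : IsProbabilityMeasure U := by
    constructor
    simp [U]
  let P := P1.prod U
  let G : (Fin d → ℝ) × ℝ → (Fin d → ℝ) → ℝ := fun a => Ω.indicator (GG g C a)
  set M := (1 + π ^ 2) * C with hMdef
  have hM0 : 0 < M := by positivity
  have hGm : Measurable (Function.uncurry G) := by
    have : Function.uncurry G = (Prod.snd ⁻¹' Ω).indicator (Function.uncurry (GG g C)) := by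
      ext ⟨a, x⟩
      by_cases hx : x ∈ Ω
      · simp [Function.uncurry, G, hx]
      · simp [Function.uncurry, G, hx]
    rw [this]
    exact (GG_meas g hg C).indicator (measurable_snd hΩm)
  have hGb : ∀ a x, |G a x| ≤ M := by
    intro a x
    by_cases hx : x ∈ Ω
    · simp only [G, Set.indicator_of_mem hx]
      exact GG_bound g hC0.le a x (hΩ hx)
    · simp only [G, Set.indicator_of_notMem hx, abs_zero]; exact hM0.le
  have hGh : ∀ x, Ω.indicator h x = ∫ a, G a x ∂P := by
    intro x
    by_cases hx : x ∈ Ω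
    · have hi : Integrable (fun a => G a x) P :=
        Integrable.of_bound (hGm.comp measurable_prodMk_right).aestronglyMeasurable M
          (Filter.Eventually.of_forall fun a => hGb a x)
      rw [integral_prod _ hi, Set.indicator_of_mem hx, hP1int, hh]
      congr 1; ext ξ
      have : ∫ t, G (ξ, t) x ∂U = C * cos (2 * π * (∑ i, ξ i * x i) + (g ξ).arg) := by
        rw [← GG_int g C ξ x (hΩ hx)]
        simp only [G, Set.indicator_of_mem hx, U]
      rw [this, ← mul_assoc, div_mul_cancel₀ _ hC0.ne']
      conv_lhs => rw [← Complex.norm_mul_exp_arg_mul_I (g ξ)]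
      rw [mul_assoc, ← Complex.exp_add, ← add_mul, ← Complex.ofReal_add, Complex.re_ofReal_mul,
        Complex.exp_ofReal_mul_I_re, add_comm]
    · simp only [G, Set.indicator_of_notMem hx, integral_zero]
  -- depth
  let ℓ := logBarron g / C
  have hlogP : Integrable (fun ξ => logb 2 (2 + l1 ξ)) P1 := by
    apply hP1i
    refine (hlog.div_const C).congr (Filter.Eventually.of_forall fun ξ => ?_)
    simp only; ring
  have hlogPint : ∫ ξ, logb 2 (2 + l1 ξ) ∂P1 = ℓ := by
    rw [hP1int]
    simp only [ℓ, logBarron]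
    rw [← integral_div]
    congr 1; ext ξ; ring
  have hlog1 : ∀ ξ : Fin d → ℝ, 1 ≤ logb 2 (2 + l1 ξ) := by
    intro ξ
    have := l1_nonneg ξ
    rw [Real.le_logb_iff_rpow_le (by norm_num) (by linarith)]; simpa using this
  have hℓ : 1 ≤ ℓ := by
    rw [← hlogPint]
    have := integral_mono (μ := P1) (integrable_const (1:ℝ)) hlogP hlog1
    simpa using this
  have hboundi : Integrable (fun ξ : Fin d → ℝ => 8 / 9 * (5 / 2 * logb 2 (2 + l1 ξ) - 2)) P1 :=
    ((hlogP.const_mul _).sub (integrable_const _)).const_mul _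
  have hkb : ∀ ξ : Fin d → ℝ, (kk ξ : ℝ) ≤ 8 / 9 * (5 / 2 * logb 2 (2 + l1 ξ) - 2) :=
    fun ξ => depth_bound (l1_nonneg ξ)
  have hki : Integrable (fun ξ : Fin d → ℝ => (kk ξ : ℝ)) P1 := by
    refine hboundi.mono' ((measurable_from_top).comp kk_meas).aestronglyMeasurable
      (Filter.Eventually.of_forall fun ξ => ?_)
    rw [Real.norm_eq_abs, abs_of_nonneg (Nat.cast_nonneg _)]
    exact hkb ξ
  have hkint : ∫ ξ, (kk ξ : ℝ) ∂P1 ≤ 8 / 9 * (5 / 2 * ℓ - 2) := by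
    refine (integral_mono hki hboundi hkb).trans_eq ?_
    rw [integral_const_mul, integral_sub (hlogP.const_mul _) (integrable_const _),
      integral_const_mul, hlogPint]
    simp
  have hκ : Integrable (fun a : (Fin d → ℝ) × ℝ => (kk a.1 : ℝ)) P := hki.comp_fst U
  have hκint : ∫ a : (Fin d → ℝ) × ℝ, (kk a.1 : ℝ) ∂P = ∫ ξ, (kk ξ : ℝ) ∂P1 := by
    have := integral_fun_fst (μ := P1) (ν := U) (fun ξ : Fin d → ℝ => (kk ξ : ℝ))
    simpa using this
  set δ := 5 / 2 * ℓ - 2 with hδ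
  have hδ0 : 0 < δ := by linarith
  set V := volume.real Ω with hV
  haveI : IsFiniteMeasure (volume.restrict Ω) := ⟨by simpa using hΩc.measure_lt_top⟩
  obtain ⟨w, hwi, hw⟩ := greedy P (volume.restrict Ω) G hGm M hGb _ hκ (9 * M ^ 2 * V / δ)
    (Ω.indicator h) hGh m
  have hVu : (volume.restrict Ω).real Set.univ = V := by simp [hV]
  rw [hVu, hκint] at hw
  set lam := 9 * M ^ 2 * V / δ with hlam
  have hlam0 : 0 < lam := by positivity
  have hm0 : (0:ℝ) < m := by exact_mod_cast hm
  have hlδ : lam * δ = 9 * M ^ 2 * V := by rw [hlam]; field_simp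
  have hrhs : m * (M ^ 2 * V + lam * ∫ ξ, (kk ξ : ℝ) ∂P1) ≤ m * (9 * M ^ 2 * V) := by
    apply mul_le_mul_of_nonneg_left _ hm0.le
    have := mul_le_mul_of_nonneg_left hkint hlam0.le
    nlinarith
  have herr0 : 0 ≤ ∫ x in Ω, (∑ i, (Ω.indicator h x - G (w i) x)) ^ 2 :=
    integral_nonneg fun x => sq_nonneg _
  have hks0 : 0 ≤ ∑ i, (kk (w i).1 : ℝ) := Finset.sum_nonneg fun i _ => Nat.cast_nonneg _
  have herr : ∫ x in Ω, (∑ i, (Ω.indicator h x - G (w i) x)) ^ 2 ≤ m * (9 * M ^ 2 * V) := by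
    have := mul_nonneg hlam0.le hks0
    linarith
  have hks : ∑ i, (kk (w i).1 : ℝ) ≤ m * δ := by
    have : lam * ∑ i, (kk (w i).1 : ℝ) ≤ lam * (m * δ) := by
      calc _ ≤ m * (9 * M ^ 2 * V) := by linarith
        _ = _ := by rw [← hlδ]; ring
    exact le_of_mul_le_mul_left this hlam0
  have hnet := fun i : Fin m => net_exists (kk (w i).1) (wt (w i).1) (bt g (w i).1)
    (C * cos (π * jj g (w i).1)) (2 * π ^ 2 * cos (π * (w i).2)) (|(w i).2| / 2)
  choose F hF1 hF2 using hnet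
  refine ⟨fun i => kk (w i).1 + 2, F, hF1, ?_, ?_⟩
  · have e : ∫⁻ x in Ω, ENNReal.ofReal ((h x - (1 / m) * ∑ i, F i x) ^ 2) =
        ∫⁻ x in Ω, ENNReal.ofReal ((1 / m) ^ 2 * (∑ i, (Ω.indicator h x - G (w i) x)) ^ 2) := by
      apply setLIntegral_congr_fun hΩm
      intro x hx
      simp only
      congr 1
      rw [Finset.sum_sub_distrib, Finset.sum_const, Finset.card_univ, Fintype.card_fin,
        Set.indicator_of_mem hx, nsmul_eq_mul]
      have : ∑ i, G (w i) x = ∑ i, F i x := by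
        refine Finset.sum_congr rfl fun i _ => ?_
        rw [hF2 i x (u_mem g _ _ (hΩ hx))]
        simp only [G, Set.indicator_of_mem hx, GG]
      rw [this]
      field_simp
    rw [e, ← ofReal_integral_eq_lintegral_ofReal (hwi.const_mul _)
      (Filter.Eventually.of_forall fun x => by positivity), integral_const_mul]
    apply ENNReal.ofReal_le_ofReal
    have hpi : 9 * M ^ 2 ≤ 12 * π ^ 4 * C ^ 2 := by
      have : 9 ≤ π ^ 2 := by nlinarith [Real.pi_gt_three]
      rw [hMdef]
      have h2 : 9 * (1 + π ^ 2) ^ 2 ≤ 12 * π ^ 4 := by nlinarith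
      calc 9 * ((1 + π ^ 2) * C) ^ 2 = 9 * (1 + π ^ 2) ^ 2 * C ^ 2 := by ring
        _ ≤ _ := mul_le_mul_of_nonneg_right h2 (sq_nonneg C)
    calc (1 / (m:ℝ)) ^ 2 * ∫ x in Ω, (∑ i, (Ω.indicator h x - G (w i) x)) ^ 2
        ≤ (1 / (m:ℝ)) ^ 2 * (m * (9 * M ^ 2 * V)) := mul_le_mul_of_nonneg_left herr (by positivity)
      _ = (9 * M ^ 2) * (V / m) := by field_simp
      _ ≤ (12 * π ^ 4 * C ^ 2) * (V / m) := mul_le_mul_of_nonneg_right hpi (by positivity)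
      _ = _ := by ring
  · push_cast
    rw [Finset.sum_add_distrib, Finset.sum_const, Finset.card_univ, Fintype.card_fin, nsmul_eq_mul]
    have : 5 / 2 * logBarron g / C = 5 / 2 * ℓ := by simp only [ℓ]; ring
    rw [this]
    nlinarith

/-- If `f : ℝ^d → ℝ` has `f̂ ∈ L¹`, `‖f‖_{B^log} < ∞` and `‖f‖_{B⁰} > 0`,
then for every `m ≥ 1` and compact `Ω ⊆ [0,1]^d` there are ReLU networks `F₁,…,F_m` of
width `3` and depths `L₁,…,L_m` with
`‖f - (1/m)∑ F_i‖²_{L²(Ω)} ≤ (3π⁴/m)|Ω|‖f‖²_{B⁰}` and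
`∑ L_i ≤ 5m ‖f‖_{B^log}/‖f‖_{B⁰}`. -/
theorem L2_approx_unit_cube (d : ℕ) (f : (Fin d → ℝ) → ℝ)
    (hf1 : Integrable (fhatR f))
    (hflog : Integrable (fun ξ => Real.logb 2 (2 + l1 ξ) * ‖fhatR f ξ‖))
    (hB0 : 0 < B0 (fhatR f))
    (m : ℕ) (hm : 0 < m)
    (Ω : Set (Fin d → ℝ)) (hΩc : IsCompact Ω) (hΩ : Ω ⊆ Set.Icc 0 1) :
    ∃ (L : Fin m → ℕ) (F : Fin m → (Fin d → ℝ) → ℝ),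
      (∀ i, IsReLUNet d 3 (L i) (F i)) ∧
      (∫⁻ x in Ω, ENNReal.ofReal ((f x - (1 / m) * ∑ i, F i x) ^ 2)) ≤
        ENNReal.ofReal (3 * Real.pi ^ 4 / m * (volume Ω).toReal * B0 (fhatR f) ^ 2) ∧
      (∑ i, (L i : ℝ)) ≤ 5 * m * logBarron (fhatR f) / B0 (fhatR f) := by
  have hfi := f_integrable f hB0
  have hinv := f_inversion f hfi hf1
  set g := hf1.aestronglyMeasurable.mk (fhatR f) with hgdef
  have hgm : Measurable g := hf1.aestronglyMeasurable.stronglyMeasurable_mk.measurable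
  have hae : fhatR f =ᵐ[volume] g := hf1.aestronglyMeasurable.ae_eq_mk
  have hgi : Integrable g := hf1.congr hae
  have hglog : Integrable (fun ξ => Real.logb 2 (2 + l1 ξ) * ‖g ξ‖) := by
    refine hflog.congr ?_
    filter_upwards [hae] with ξ hξ
    rw [hξ]
  have hlB : logBarron (fhatR f) = logBarron g := by
    refine integral_congr_ae ?_
    filter_upwards [hae] with ξ hξ
    rw [hξ]
  have hB : B0 (fhatR f) = 2 * ∫ ξ, ‖g ξ‖ := by
    simp only [B0]
    congr 1
    refine integral_congr_ae ?_
    filter_upwards [hae] with ξ hξ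
    rw [hξ]
  set C := ∫ ξ, ‖g ξ‖ with hC
  rw [hB] at hB0 ⊢
  rw [hlB]
  have hC0 : 0 < C := by linarith
  have hm0 : (0:ℝ) < m := by exact_mod_cast hm
  rcases (measureReal_nonneg (μ := volume) (s := Ω)).eq_or_lt with hv | hv
  · have hv0 : volume Ω = 0 := by
      rcases (ENNReal.toReal_eq_zero_iff _).1 hv.symm with h | h
      · exact h
      · exact absurd h hΩc.measure_lt_top.ne
    refine ⟨fun _ => 2, fun _ _ => 0, fun _ => ⟨0, 0, 0, 0, 0, fun x => by simp⟩, ?_, ?_⟩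
    · rw [Measure.restrict_eq_zero.2 hv0]; simp
    · have hle : C ≤ logBarron g := by
        refine integral_mono hgi.norm hglog fun ξ => ?_
        have h0 := l1_nonneg ξ
        have : 1 ≤ logb 2 (2 + l1 ξ) := by
          rw [Real.le_logb_iff_rpow_le (by norm_num) (by linarith)]; simpa using h0
        exact le_mul_of_one_le_left (norm_nonneg _) this
      rw [le_div_iff₀ hB0]
      simp only [Finset.sum_const, Finset.card_univ, Fintype.card_fin, nsmul_eq_mul]
      push_cast
      nlinarith
  · obtain ⟨L, F, h1, h2, h3⟩ := core g hgm hgi hglog C hC hC0 Ω hΩc hΩ hv m hm _ (fun x => rfl)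
    refine ⟨L, F, h1, ?_, h3.trans_eq (by field_simp)⟩
    have hfx : ∀ᵐ x ∂(volume.restrict Ω), f x = ∫ ξ : Fin d → ℝ, (g ξ * Complex.exp
      (((2 * Real.pi * (∑ i, ξ i * x i) : ℝ) : ℂ) * Complex.I)).re := by
      refine ae_restrict_of_ae ?_
      filter_upwards [hinv] with x hx
      rw [hx]
      refine integral_congr_ae ?_
      filter_upwards [hae] with ξ hξ
      rw [hξ]
    refine (lintegral_congr_ae ?_).trans_le (h2.trans_eq ?_)
    · filter_upwards [hfx] with x hx
      rw [hx]
    · congr 1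
      simp only [Measure.real]
      ring

end
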